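/- Let φ be a Legendre and 1-coercive dgf, and let f : X → ℝ ∪ {±∞} be proper, lsc on X, and convex, with dom f ∩ int X ≠ ∅; let f̃ be its canonical extension. Then the following are equivalent: (a) f is differentiable on int X and φ − f is convex on int X (f is B-smooth relative to φ); (b) dom f = X and f = φ − h*(−·) on int X, where h : ℝⁿ → ℝ ∪ {±∞} is h(η) := sup_{ξ∈ℝⁿ} { φ*(ξ − η) − f̃*(ξ) }; (c) f is differentiable on int X and for every x̄ ∈ int X and every pair (x, ξ) with x ∈ X and ξ ∈ ∂f(x) (the Fenchel subdifferential of f, which for proper lsc convex f coincides with the limiting subdifferential): f(x̄) − f(x) − ⟨ξ, x̄ − x⟩ ≥ D*(∇φ(x̄) − (∇f(x̄) − ξ), ∇φ(x̄)); (d) for all ξ, ξ̄ ∈ ℝⁿ and all x̄ ∈ ∂f̃*(ξ̄) ∩ int X: f̃*(ξ) ≥ f̃*(ξ̄) + φ*(ξ − ξ̄ + ∇φ(x̄)) − φ*(∇φ(x̄)). Each of these equivalent conditions implies: (e) f is differentiable on int X and D_f(x̄, x) ≥ D*(∇φ(x̄) − (∇f(x̄) − ∇f(x)), ∇φ(x̄))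 for all x, x̄ ∈ int X, where D_f(x̄, x) := f(x̄) − f(x) − ⟨∇f(x), x̄ − x⟩. Conversely, if dom ∂f ⊆ int X, then (e) implies (a)–(d). -/

import Mathlib

open Filter Topology Bornology Set RealInnerProductSpace Classical

noncomputable section

namespace BregmanPaper

/-- Euclidean space `ℝⁿ`. -/
abbrev Eucl (n : ℕ) := EuclideanSpace ℝ (Fin n)

variable {n : ℕ}

/-! ### Set-valued operators between subsets of `ℝⁿ` -/

/-- `T : X ⇉ Y` is locally bounded at `x` (relative to `X`): some neighborhood `N` of `x`
in `X` has bounded image `T(N)`. -/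
def LocBddAt (X : Set (Eucl n)) (T : Eucl n → Set (Eucl n)) (x : Eucl n) : Prop :=
  ∃ N : Set (Eucl n), N ⊆ X ∧ N ∈ 𝓝[X] x ∧ IsBounded (⋃ x' ∈ N, T x')

/-- `T : X ⇉ Y` is upper semicontinuous at `x`: for every open `V ⊇ T(x)` there is a
neighborhood `N` of `x` in `X` with `T(N) ⊆ V`. -/
def UscAt (X : Set (Eucl n)) (T : Eucl n → Set (Eucl n)) (x : Eucl n) : Prop :=
  ∀ V : Set (Eucl n), IsOpen V → T x ⊆ V →
    ∃ N : Set (Eucl n), N ⊆ X ∧ N ∈ 𝓝[X] x ∧ (⋃ x' ∈ N, T x') ⊆ V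

/-- `T : X ⇉ Y` is outer semicontinuous at `x`: every `y ∈ Y` which is the limit of a
sequence `yᵏ ∈ T(xᵏ)` with `X ∋ xᵏ → x` belongs to `T(x)`. -/
def OscAt (X Y : Set (Eucl n)) (T : Eucl n → Set (Eucl n)) (x : Eucl n) : Prop :=
  ∀ y ∈ Y, ∀ u v : ℕ → Eucl n, (∀ k, u k ∈ X) → (∀ k, v k ∈ T (u k)) →
    Tendsto u atTop (𝓝 x) → Tendsto v atTop (𝓝 y) → y ∈ T x

/-- (effective) domain of a set-valued operator on `X`. -/
def svDom (X : Set (Eucl n)) (T : Eucl n → Set (Eucl n)) : Set (Eucl n) :=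
  {x ∈ X | (T x).Nonempty}

/-- graph of a set-valued operator on `X`. -/
def svGraph (X : Set (Eucl n)) (T : Eucl n → Set (Eucl n)) : Set (Eucl n × Eucl n) :=
  {p | p.1 ∈ X ∧ p.2 ∈ T p.1}

/-! ### Extended-real-valued functions on subsets of `ℝⁿ` -/

/-- Canonical extension of `f : X → ℝ̄`, set to `∞` outside `X`. -/
def cExt (X : Set (Eucl n)) (f : Eucl n → EReal) : Eucl n → EReal :=
  fun x => if x ∈ X then f x else ⊤

/-- `f : X → ℝ̄` is proper: not identically `∞` and nowhere `-∞` (on `X`). -/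
def ProperOn (X : Set (Eucl n)) (f : Eucl n → EReal) : Prop :=
  (∃ x ∈ X, f x ≠ ⊤) ∧ ∀ x ∈ X, f x ≠ ⊥

/-- Convexity of an extended-real-valued function on a set. -/
def ConvexOnE (S : Set (Eucl n)) (f : Eucl n → EReal) : Prop :=
  ∀ x ∈ S, ∀ y ∈ S, ∀ a b : ℝ, 0 ≤ a → 0 ≤ b → a + b = 1 →
    f (a • x + b • y) ≤ (a : EReal) * f x + (b : EReal) * f y

/-- Strict convexity of an extended-real-valued function on a set. -/
def StrictConvexOnE (S : Set (Eucl n)) (f : Eucl n → EReal) : Prop :=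
  ∀ x ∈ S, ∀ y ∈ S, x ≠ y → ∀ a b : ℝ, 0 < a → 0 < b → a + b = 1 →
    f (a • x + b • y) < (a : EReal) * f x + (b : EReal) * f y

/-- Lower semicontinuous hull of `f` relative to `X`: `cl f (x) = liminf_{X ∋ x' → x} f x'`. -/
def lscHullOn (X : Set (Eucl n)) (f : Eucl n → EReal) : Eucl n → EReal :=
  fun x => Filter.liminf f (𝓝[X] x)

/-- Convex hull of `f` relative to `X`: pointwise supremum of all convex minorants on `X`. -/
def convHullOn (X : Set (Eucl n)) (f : Eucl n → EReal) : Eucl n → EReal :=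
  fun x => sSup {v : EReal | ∃ g : Eucl n → EReal,
    ConvexOnE X g ∧ (∀ y ∈ X, g y ≤ f y) ∧ v = g x}

/-- Closed convex hull of `f` relative to `X`: pointwise supremum of all convex minorants
on `X` that are additionally lsc on `X`. -/
def cconvHullOn (X : Set (Eucl n)) (f : Eucl n → EReal) : Eucl n → EReal :=
  fun x => sSup {v : EReal | ∃ g : Eucl n → EReal,
    ConvexOnE X g ∧ LowerSemicontinuousOn g X ∧ (∀ y ∈ X, g y ≤ f y) ∧ v = g x}

/-- Fenchel conjugate of `h : ℝⁿ → ℝ̄`. -/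
def fconj (h : Eucl n → EReal) : Eucl n → EReal :=
  fun y => ⨆ x : Eucl n, ((⟪x, y⟫ : ℝ) : EReal) - h x

/-- Fenchel subdifferential of `f` at `x`, relative to the set `X`. -/
def fsubdiff (X : Set (Eucl n)) (f : Eucl n → EReal) (x : Eucl n) : Set (Eucl n) :=
  {u : Eucl n | ∀ x' ∈ X, f x + ((⟪u, x' - x⟫ : ℝ) : EReal) ≤ f x'}

/-- Set of minimizers of `h` over `S`. -/
def argminOn (S : Set (Eucl n)) (h : Eucl n → EReal) : Set (Eucl n) :=
  {x ∈ S | ∀ x' ∈ S, h x ≤ h x'}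

/-- `h` is 1-coercive: `h(x)/‖x‖ → ∞` as `‖x‖ → ∞`. -/
def OneCoercive (h : Eucl n → EReal) : Prop :=
  ∀ M : ℝ, ∃ R : ℝ, ∀ x : Eucl n, R ≤ ‖x‖ → ((M * ‖x‖ : ℝ) : EReal) ≤ h x

/-- `h` is coercive: `h(x) → ∞` as `‖x‖ → ∞`. -/
def CoerciveE (h : Eucl n → EReal) : Prop :=
  ∀ M : ℝ, ∃ R : ℝ, ∀ x : Eucl n, R ≤ ‖x‖ → ((M : ℝ) : EReal) ≤ h x

/-! ### Distance generating functions and Bregman objects -/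

/-- Effective domain of an `EReal`-valued function. -/
def edom (φ : Eucl n → EReal) : Set (Eucl n) := {x | φ x ≠ ⊤}

/-- `φ` is a distance generating function with gradient `φ'` on the interior of its domain:
proper, lsc, convex, and differentiable on `int dom φ ≠ ∅`. -/
structure IsDGF (φ : Eucl n → EReal) (φ' : Eucl n → Eucl n) : Prop where
  nonempty_dom : ∃ x, φ x ≠ ⊤
  ne_bot : ∀ x, φ x ≠ ⊥
  lsc : LowerSemicontinuous φ
  convex : ConvexOnE Set.univ φ
  int_nonempty : (interior (edom φ)).Nonempty
  diff : ∀ x ∈ interior (edom φ), HasGradientAt (fun z => (φ z).toReal) (φ' x) x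

/-- Essential smoothness of `φ` (with gradient `φ'`). -/
def EssSmooth (φ : Eucl n → EReal) (φ' : Eucl n → Eucl n) : Prop :=
  (interior (edom φ)).Nonempty ∧
  (∀ x ∈ interior (edom φ), HasGradientAt (fun z => (φ z).toReal) (φ' x) x) ∧
  ∀ (u : ℕ → Eucl n) (x : Eucl n), (∀ k, u k ∈ interior (edom φ)) →
    x ∈ frontier (edom φ) → Tendsto u atTop (𝓝 x) →
    Tendsto (fun k => ‖φ' (u k)‖) atTop atTop

/-- `φ` is Legendre: essentially smooth and essentially strictly convex. -/
def Legendre (φ : Eucl n → EReal) (φ' : Eucl n → Eucl n) : Prop :=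
  EssSmooth φ φ' ∧
  ∀ S : Set (Eucl n), S ⊆ {x | (fsubdiff Set.univ φ x).Nonempty} → Convex ℝ S →
    StrictConvexOnE S φ

/-- Bregman distance induced by `φ` (with gradient `φ'`). -/
def breg (φ : Eucl n → EReal) (φ' : Eucl n → Eucl n) (x y : Eucl n) : EReal :=
  if y ∈ interior (edom φ) then φ x - φ y - ((⟪φ' y, x - y⟫ : ℝ) : EReal) else ⊤

/-- Left Bregman–Moreau envelope `env_λ f`. -/
def benv (φ : Eucl n → EReal) (φ' : Eucl n → Eucl n) (lam : ℝ) (f : Eucl n → EReal)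
    (y : Eucl n) : EReal :=
  ⨅ x ∈ edom φ, (f x + ((lam⁻¹ : ℝ) : EReal) * breg φ φ' x y)

/-- Left Bregman proximal mapping `prox_{λ f}`. -/
def bprox (φ : Eucl n → EReal) (φ' : Eucl n → Eucl n) (lam : ℝ) (f : Eucl n → EReal)
    (y : Eucl n) : Set (Eucl n) :=
  argminOn (edom φ) (fun x => f x + ((lam⁻¹ : ℝ) : EReal) * breg φ φ' x y)

/-- Right Bregman–Moreau envelope `env*_λ g`. -/
def benvR (φ : Eucl n → EReal) (φ' : Eucl n → Eucl n) (lam : ℝ) (g : Eucl n → EReal)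
    (x : Eucl n) : EReal :=
  ⨅ y ∈ interior (edom φ), (g y + ((lam⁻¹ : ℝ) : EReal) * breg φ φ' x y)

/-- Right Bregman proximal mapping `prox*_{λ g}`. -/
def bproxR (φ : Eucl n → EReal) (φ' : Eucl n → Eucl n) (lam : ℝ) (g : Eucl n → EReal)
    (x : Eucl n) : Set (Eucl n) :=
  argminOn (interior (edom φ)) (fun y => g y + ((lam⁻¹ : ℝ) : EReal) * breg φ φ' x y)

/-- Left Bregman proximal hull `hull_λ f = −env*_λ(−env_λ f)`. -/
def bhull (φ : Eucl n → EReal) (φ' : Eucl n → Eucl n) (lam : ℝ) (f : Eucl n → EReal) :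
    Eucl n → EReal :=
  fun x => - benvR φ φ' lam (fun y => - benv φ φ' lam f y) x

/-- Right Bregman proximal hull `hull*_λ g = −env_λ(−env*_λ g)`. -/
def bhullR (φ : Eucl n → EReal) (φ' : Eucl n → Eucl n) (lam : ℝ) (g : Eucl n → EReal) :
    Eucl n → EReal :=
  fun y => - benv φ φ' lam (fun x => - benvR φ φ' lam g x) y

/-- `f` is `φ`-prox-bounded for the parameter `lam`. -/
def ProxBddBelow (φ : Eucl n → EReal) (φ' : Eucl n → Eucl n) (lam : ℝ)
    (f : Eucl n → EReal) : Prop :=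
  ∃ y ∈ interior (edom φ), benv φ φ' lam f y ≠ ⊥

/-- `g` is right `φ`-prox-bounded for the parameter `lam`. -/
def ProxBddBelowR (φ : Eucl n → EReal) (φ' : Eucl n → Eucl n) (lam : ℝ)
    (g : Eucl n → EReal) : Prop :=
  ∃ x ∈ edom φ, benvR φ φ' lam g x ≠ ⊥

/-- The (left) `φ`-prox-boundedness threshold `λ_f` of `f` (in `[0,∞]`). -/
def pbThreshold (φ : Eucl n → EReal) (φ' : Eucl n → Eucl n) (f : Eucl n → EReal) :
    ENNReal :=
  ⨆ l ∈ {l : ℝ | 0 < l ∧ ProxBddBelow φ φ' l f}, ENNReal.ofReal l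

/-- The right `φ`-prox-boundedness threshold `λ̄_g` of `g` (in `[0,∞]`). -/
def pbThresholdR (φ : Eucl n → EReal) (φ' : Eucl n → Eucl n) (g : Eucl n → EReal) :
    ENNReal :=
  ⨆ l ∈ {l : ℝ | 0 < l ∧ ProxBddBelowR φ φ' l g}, ENNReal.ofReal l

/-- Epi-composition `(∇φ ▷ g)(ξ) = inf {g(y) : y ∈ Y, ∇φ(y) = ξ}`. -/
def epicomp (φ' : Eucl n → Eucl n) (Y : Set (Eucl n)) (g : Eucl n → EReal) :
    Eucl n → EReal :=
  fun ξ => ⨅ y ∈ {y ∈ Y | φ' y = ξ}, g y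

/-- Indicator function (in the `EReal` sense) of a set. -/
def indicatorE (S : Set (Eucl n)) : Eucl n → EReal := fun x => if x ∈ S then 0 else ⊤

/-! ### Euclidean proximal objects -/

/-- Euclidean Moreau envelope. -/
def eEnv (lam : ℝ) (h : Eucl n → EReal) (v : Eucl n) : EReal :=
  ⨅ x : Eucl n, (h x + (((2 * lam)⁻¹ * ‖x - v‖ ^ 2 : ℝ) : EReal))

/-- Euclidean proximal mapping. -/
def eProx (lam : ℝ) (h : Eucl n → EReal) (v : Eucl n) : Set (Eucl n) :=
  argminOn Set.univ (fun x => h x + (((2 * lam)⁻¹ * ‖x - v‖ ^ 2 : ℝ) : EReal))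

/-- Euclidean proximal hull. -/
def eHull (lam : ℝ) (h : Eucl n → EReal) : Eucl n → EReal :=
  fun v => - eEnv lam (fun w => - eEnv lam h w) v


lemma convE_le {S : Set (Eucl n)} {f : Eucl n → EReal} (h : ConvexOnE S f) {x y : Eucl n}
    (hx : x ∈ S) (hy : y ∈ S) {a b : ℝ} (ha : 0 ≤ a) (hb : 0 ≤ b) (hab : a + b = 1)
    {p q : ℝ} (hp : f x ≤ (p : EReal)) (hq : f y ≤ (q : EReal)) :
    f (a • x + b • y) ≤ ((a * p + b * q : ℝ) : EReal) := by
  refine (h x hx y hy a b ha hb hab).trans ?_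
  rw [EReal.coe_add, EReal.coe_mul, EReal.coe_mul]
  exact add_le_add (mul_le_mul_of_nonneg_left hp (by exact_mod_cast ha))
    (mul_le_mul_of_nonneg_left hq (by exact_mod_cast hb))

/-- From approximate local support to global support. -/
lemma support_global {Z : Set (Eucl n)} {f : Eucl n → EReal} (h : ConvexOnE Z f)
    {p ξ : Eucl n} {c : ℝ} (hp : p ∈ Z) (hpc : f p = (c : EReal))
    (hloc : ∀ ε > 0, ∀ᶠ y in 𝓝 p,
      ((c + ⟪ξ, y - p⟫ - ε * ‖y - p‖ : ℝ) : EReal) ≤ f y) :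
    ξ ∈ fsubdiff Z f p := by
  intro z hz
  rw [hpc, ← EReal.coe_add]
  by_contra hcon
  rw [not_le] at hcon
  obtain ⟨b, hb1, hb2⟩ := EReal.lt_iff_exists_real_btwn.1 hcon
  have hb2 : b < c + ⟪ξ, z - p⟫ := by exact_mod_cast hb2
  have key : ∀ ε > 0, c + ⟪ξ, z - p⟫ - ε * ‖z - p‖ ≤ b := by
    intro ε hε
    have htend : Tendsto (fun t : ℝ => p + t • (z - p)) (𝓝[>] 0) (𝓝 p) := by
      have : ContinuousAt (fun t : ℝ => p + t • (z - p)) 0 := by fun_prop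
      have := this.tendsto
      simp only [zero_smul, add_zero] at this
      exact this.mono_left nhdsWithin_le_nhds
    have h1 : ∀ᶠ t : ℝ in 𝓝[>] 0, t < 1 :=
      nhdsWithin_le_nhds (Iio_mem_nhds (by norm_num))
    obtain ⟨t, ht, ht1, ht0⟩ :=
      ((htend.eventually (hloc ε hε)).and (h1.and self_mem_nhdsWithin)).exists
    have ht0 : 0 < t := ht0
    have h2 := convE_le h hp hz (a := 1 - t) (b := t) (by linarith) ht0.le (by ring)
      hpc.le hb1.le
    have e : (1 - t) • p + t • z = p + t • (z - p) := by
      rw [sub_smul, smul_sub, one_smul]; abel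
    rw [e] at h2
    have h3 := ht.trans h2
    have h3 : c + ⟪ξ, p + t • (z - p) - p⟫ - ε * ‖p + t • (z - p) - p‖
      ≤ (1 - t) * c + t * b := by exact_mod_cast h3
    rw [add_sub_cancel_left, inner_smul_right, norm_smul, Real.norm_of_nonneg ht0.le] at h3
    have h4 : t * (c + ⟪ξ, z - p⟫ - ε * ‖z - p‖) ≤ t * b := by nlinarith
    exact le_of_mul_le_mul_left h4 ht0
  have hd : 0 < c + ⟪ξ, z - p⟫ - b := by linarith
  have hn : 0 ≤ ‖z - p‖ := norm_nonneg _
  have := key ((c + ⟪ξ, z - p⟫ - b) / (2 * (‖z - p‖ + 1))) (by positivity)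
  have h5 : (c + ⟪ξ, z - p⟫ - b) / (2 * (‖z - p‖ + 1)) * ‖z - p‖ < c + ⟪ξ, z - p⟫ - b := by
    rw [div_mul_eq_mul_div, div_lt_iff₀ (by positivity)]
    nlinarith
  linarith

lemma exists_subgrad_real {S : Set (Eucl n)} (hS : IsOpen S) {F : Eucl n → ℝ}
    (hF : ConvexOn ℝ S F) {x : Eucl n} (hx : x ∈ S) :
    ∃ a : Eucl n, ∀ y ∈ S, F x + ⟪a, y - x⟫ ≤ F y := by
  have hc : ContinuousOn F S := hF.continuousOn hS
  set T : Set (Eucl n × ℝ) := {p | p.1 ∈ S ∧ F p.1 < p.2} with hT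
  have hTc : Convex ℝ T := hF.convex_strict_epigraph
  have hTo : IsOpen T := by
    rw [isOpen_iff_mem_nhds]
    rintro ⟨y, t⟩ ⟨hy, ht⟩
    have h1 : ContinuousAt (fun p : Eucl n × ℝ => F p.1) (y, t) :=
      ContinuousAt.comp (f := Prod.fst) (hc.continuousAt (hS.mem_nhds hy)) continuousAt_fst
    have h2 : ∀ᶠ p : Eucl n × ℝ in 𝓝 (y, t), F p.1 < p.2 :=
      h1.eventually_lt continuousAt_snd ht
    have h3 : ∀ᶠ p : Eucl n × ℝ in 𝓝 (y, t), p.1 ∈ S :=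
      continuousAt_fst.eventually (hS.mem_nhds hy)
    exact h3.and h2
  obtain ⟨l, hl⟩ := geometric_hahn_banach_open_point hTc hTo (x := (x, F x))
    (fun h => lt_irrefl _ h.2)
  set s : ℝ := l (0, 1) with hs
  set m : StrongDual ℝ (Eucl n) := l.comp (ContinuousLinearMap.inl ℝ (Eucl n) ℝ) with hm
  have hl' : ∀ y t, l (y, t) = m y + t * s := by
    intro y t
    have : (y, t) = ContinuousLinearMap.inl ℝ (Eucl n) ℝ y + t • ((0 : Eucl n), (1 : ℝ)) := by
      simp
    rw [this, map_add, map_smul]; rfl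
  have hs0 : s < 0 := by
    have := hl (x, F x + 1) ⟨hx, by simp⟩
    rw [hl', hl'] at this
    linarith
  have key : ∀ y ∈ S, m y + F y * s ≤ m x + F x * s := by
    intro y hy
    refine le_of_forall_pos_le_add fun ε hε => ?_
    have := hl (y, F y + ε / (-s)) ⟨hy, by
      have : 0 < ε / (-s) := div_pos hε (by linarith)
      simp only; linarith⟩
    rw [hl', hl'] at this
    have h2 : ε / (-s) * s = -ε := by
      have : s ≠ 0 := hs0.ne
      field_simp
    nlinarith
  refine ⟨(InnerProductSpace.toDual ℝ (Eucl n)).symm ((-s)⁻¹ • m), fun y hy => ?_⟩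
  rw [InnerProductSpace.toDual_symm_apply]
  have h1 := key y hy
  have h2 : ((-s)⁻¹ • m) (y - x) = (m y - m x) / (-s) := by
    simp [map_sub]; ring
  rw [h2]
  have h3 : (m y - m x) / (-s) ≤ F y - F x := by
    rw [div_le_iff₀ (by linarith)]
    nlinarith
  linarith

lemma grad_unique {F : Eucl n → ℝ} {g ξ x : Eucl n} (hF : HasGradientAt F g x)
    (h : ∀ᶠ y in 𝓝 x, F x + ⟪ξ, y - x⟫ ≤ F y) : g = ξ := by
  have h1 : IsLocalMin (fun y => F y - ⟪ξ, y⟫) x := by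
    filter_upwards [h] with y hy
    rw [inner_sub_right] at hy
    linarith
  have h2 : HasFDerivAt (fun y => F y - ⟪ξ, y⟫)
      (InnerProductSpace.toDual ℝ (Eucl n) g - InnerProductSpace.toDual ℝ (Eucl n) ξ) x :=
    (hasGradientAt_iff_hasFDerivAt.1 hF).sub
      ((InnerProductSpace.toDual ℝ (Eucl n) ξ).hasFDerivAt)
  have h3 := h1.hasFDerivAt_eq_zero h2
  exact (InnerProductSpace.toDual ℝ (Eucl n)).injective (sub_eq_zero.1 h3)

lemma grad_eps {F : Eucl n → ℝ} {g x : Eucl n} (hF : HasGradientAt F g x) {ε : ℝ} (hε : 0 < ε) :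
    ∀ᶠ y in 𝓝 x, |F y - F x - ⟪g, y - x⟫| ≤ ε * ‖y - x‖ := by
  have := (hasGradientAt_iff_isLittleO.1 hF).def hε
  simpa using this

lemma grad_of_eps {F : Eucl n → ℝ} {g x : Eucl n} (h : ∀ ε > 0,
    ∀ᶠ y in 𝓝 x, |F y - F x - ⟪g, y - x⟫| ≤ ε * ‖y - x‖) : HasGradientAt F g x := by
  rw [hasGradientAt_iff_isLittleO, Asymptotics.isLittleO_iff]
  intro ε hε
  simpa using h ε hε

lemma coe_tr {x : EReal} (h1 : x ≠ ⊤) (h2 : x ≠ ⊥) : x = ((x.toReal : ℝ) : EReal) :=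
  (EReal.coe_toReal h1 h2).symm

lemma lsc_min {K : Set (Eucl n)} (hK : IsCompact K) (hne : K.Nonempty) {f : Eucl n → EReal}
    (hf : LowerSemicontinuousOn f K) {g : Eucl n → ℝ} (hg : Continuous g) :
    ∃ p ∈ K, ∀ y ∈ K, f p + (g p : EReal) ≤ f y + (g y : EReal) := by
  have hl : LowerSemicontinuousOn (fun y => f y + (g y : EReal)) K := by
    refine LowerSemicontinuousOn.add' hf ?_ ?_
    · exact (continuous_coe_real_ereal.comp hg).lowerSemicontinuous.lowerSemicontinuousOn _
    · intro x hx
      apply EReal.continuousAt_add <;> simp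
  obtain ⟨p, hp, hmin⟩ := LowerSemicontinuousOn.exists_isMinOn hne hK hl
  exact ⟨p, hp, fun y hy => hmin hy⟩

lemma convex_edom {φ : Eucl n → EReal} (h : ConvexOnE Set.univ φ) :
    Convex ℝ (edom φ) := by
  intro x hx y hy a b ha hb hab
  have hx' : φ x ≤ ((φ x).toReal : EReal) := EReal.le_coe_toReal hx
  have hy' : φ y ≤ ((φ y).toReal : EReal) := EReal.le_coe_toReal hy
  have := convE_le h (mem_univ x) (mem_univ y) ha hb hab hx' hy'
  exact (this.trans_lt (EReal.coe_lt_top _)).ne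

lemma grad_sub {Z : Set (Eucl n)} {f : Eucl n → EReal} (h : ConvexOnE Z f)
    {p g : Eucl n} (hp : p ∈ interior Z) (hpt : f p ≠ ⊤) (hbot : ∀ y ∈ Z, f y ≠ ⊥)
    (hg : HasGradientAt (fun z => (f z).toReal) g p) : g ∈ fsubdiff Z f p := by
  have hpZ := interior_subset hp
  refine support_global h hpZ (coe_tr hpt (hbot p hpZ)) fun ε hε => ?_
  filter_upwards [grad_eps hg hε, mem_interior_iff_mem_nhds.1 hp] with y hy hyZ
  by_cases hyt : f y = ⊤
  · rw [hyt]; exact le_top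
  · rw [coe_tr hyt (hbot y hyZ)]
    have := abs_le.1 hy
    exact_mod_cast by linarith

lemma sub_real {Z : Set (Eucl n)} {f : Eucl n → EReal} {p g y : Eucl n}
    (hg : g ∈ fsubdiff Z f p) (hp : p ∈ Z) (hy : y ∈ Z) (hpt : f p ≠ ⊤) (hyt : f y ≠ ⊤)
    (hbot : ∀ y ∈ Z, f y ≠ ⊥) : (f p).toReal + ⟪g, y - p⟫ ≤ (f y).toReal := by
  have := hg y hy
  rw [coe_tr hpt (hbot p hp), coe_tr hyt (hbot y hy)] at this
  exact_mod_cast this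

lemma sub_of_real {Z : Set (Eucl n)} {f : Eucl n → EReal} {p g : Eucl n}
    (hp : p ∈ Z) (hpt : f p ≠ ⊤) (hbot : ∀ y ∈ Z, f y ≠ ⊥)
    (h : ∀ y ∈ Z, f y ≠ ⊤ → (f p).toReal + ⟪g, y - p⟫ ≤ (f y).toReal) :
    g ∈ fsubdiff Z f p := by
  intro y hy
  by_cases hyt : f y = ⊤
  · rw [hyt]; exact le_top
  · rw [coe_tr hpt (hbot p hp), coe_tr hyt (hbot y hy)]
    exact_mod_cast h y hy hyt

section phi

variable {φ : Eucl n → EReal} {φ' : Eucl n → Eucl n}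

lemma phi_grad (hφ : IsDGF φ φ') {x y : Eucl n} (hx : x ∈ interior (edom φ)) (hy : y ∈ edom φ) :
    (φ x).toReal + ⟪φ' x, y - x⟫ ≤ (φ y).toReal :=
  sub_real (Z := Set.univ) (grad_sub hφ.convex (by simp) (interior_subset hx)
    (fun y _ => hφ.ne_bot y) (hφ.diff x hx)) (mem_univ _) (mem_univ _) (interior_subset hx) hy
    (fun y _ => hφ.ne_bot y)

lemma phi_attain (hφ : IsDGF φ φ') (hco : OneCoercive φ) (u : Eucl n) :
    ∃ x ∈ edom φ, ∀ y ∈ edom φ, (φ x).toReal + ⟪u, y - x⟫ ≤ (φ y).toReal := by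
  obtain ⟨x0, hx0⟩ := hφ.nonempty_dom
  obtain ⟨R, hR⟩ := hco (‖u‖ + 1)
  set c := (φ x0).toReal - ⟪u, x0⟫ with hc
  set R' := max R (max c ‖x0‖) with hR'
  have h1 : R ≤ R' := le_max_left _ _
  have h2 : c ≤ R' := (le_max_left _ _).trans (le_max_right _ _)
  have h3 : ‖x0‖ ≤ R' := (le_max_right _ _).trans (le_max_right _ _)
  have hx0K : x0 ∈ Metric.closedBall (0 : Eucl n) R' := by simpa using h3
  obtain ⟨p, hp, hmin⟩ := lsc_min (isCompact_closedBall (0 : Eucl n) R') ⟨x0, hx0K⟩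
    (hφ.lsc.lowerSemicontinuousOn _) (g := fun y => - ⟪u, y⟫) (by fun_prop)
  have hpt : φ p ≠ ⊤ := by
    intro h
    have := hmin x0 hx0K
    rw [h, EReal.top_add_coe, top_le_iff, coe_tr hx0 (hφ.ne_bot x0)] at this
    exact EReal.coe_ne_top _ (by exact_mod_cast this)
  have hmr : ∀ y ∈ Metric.closedBall (0 : Eucl n) R', y ∈ edom φ →
      (φ p).toReal - ⟪u, p⟫ ≤ (φ y).toReal - ⟪u, y⟫ := by
    intro y hy hyt
    have := hmin y hy
    rw [coe_tr hpt (hφ.ne_bot p), coe_tr hyt (hφ.ne_bot y)] at this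
    have : (φ p).toReal + -⟪u, p⟫ ≤ (φ y).toReal + -⟪u, y⟫ := by exact_mod_cast this
    linarith
  refine ⟨p, hpt, fun y hy => ?_⟩
  rw [inner_sub_right]
  by_cases hyK : y ∈ Metric.closedBall (0 : Eucl n) R'
  · linarith [hmr y hyK hy]
  · have hyn : R' < ‖y‖ := by simpa using hyK
    have h4 := hR y (h1.trans hyn.le)
    rw [coe_tr hy (hφ.ne_bot y)] at h4
    have h4 : (‖u‖ + 1) * ‖y‖ ≤ (φ y).toReal := by exact_mod_cast h4
    have h5 := hmr x0 hx0K hx0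
    have h6 : ⟪u, y⟫ ≤ ‖u‖ * ‖y‖ := real_inner_le_norm _ _
    linarith

lemma phi_int (hφ : IsDGF φ φ') (hL : Legendre φ φ') {v xh : Eucl n} (hxh : xh ∈ edom φ)
    (hv : ∀ y ∈ edom φ, (φ xh).toReal + ⟪v, y - xh⟫ ≤ (φ y).toReal) :
    xh ∈ interior (edom φ) := by
  by_contra hni
  have hfr : xh ∈ frontier (edom φ) := ⟨subset_closure hxh, hni⟩
  obtain ⟨x0, hx0⟩ := hφ.int_nonempty
  have hcont : ContinuousAt (fun z => (φ z).toReal) x0 := (hφ.diff x0 hx0).differentiableAt.continuousAt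
  have hev : ∀ᶠ y in 𝓝 x0, y ∈ edom φ ∧ (φ y).toReal ≤ (φ x0).toReal + 1 :=
    Filter.Eventually.and (mem_interior_iff_mem_nhds.1 hx0)
      (hcont.eventually (eventually_le_nhds (by linarith)))
  obtain ⟨r, hr, hball⟩ := Metric.nhds_basis_closedBall.eventually_iff.1 hev
  set t : ℕ → ℝ := fun k => 1 / ((k : ℝ) + 1) with ht
  have ht0 : ∀ k, 0 < t k := fun k => by positivity
  have ht1 : ∀ k, t k ≤ 1 := fun k => by
    rw [ht]; simp only
    rw [div_le_one (by positivity)]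
    have : (0:ℝ) ≤ k := by positivity
    linarith
  set u : ℕ → Eucl n := fun k => xh + t k • (x0 - xh) with hu
  have hui : ∀ k, u k ∈ interior (edom φ) := fun k =>
    (convex_edom hφ.convex).add_smul_sub_mem_interior hxh hx0 ⟨ht0 k, ht1 k⟩
  have hut : Tendsto u atTop (𝓝 xh) := by
    have h1 : Tendsto t atTop (𝓝 0) := tendsto_one_div_add_atTop_nhds_zero_nat
    have h2 : Tendsto u atTop (𝓝 (xh + (0:ℝ) • (x0 - xh))) :=
      tendsto_const_nhds.add (h1.smul_const _)
    simpa using h2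
  have hinf := hL.1.2.2 u xh hui hfr hut
  set α := ⟪v, x0 - xh⟫ with hα
  have hbd : ∀ k, r * ‖φ' (u k)‖ ≤ (φ x0).toReal + 1 - (φ xh).toReal + 2 * |α| := by
    intro k
    set g := φ' (u k) with hg
    have huk : u k - xh = t k • (x0 - xh) := by simp [hu]
    have huk2 : xh - u k = - (t k • (x0 - xh)) := by rw [← huk]; abel
    have huk3 : x0 - u k = (1 - t k) • (x0 - xh) := by
      rw [sub_smul, one_smul, ← huk]; abel
    have e1 := hv (u k) (interior_subset (hui k))
    rw [huk, inner_smul_right] at e1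
    have e2 := phi_grad hφ (hui k) hxh
    rw [huk2, inner_neg_right, inner_smul_right] at e2
    have e3 : α ≤ ⟪g, x0 - xh⟫ := by
      have : t k * α ≤ t k * ⟪g, x0 - xh⟫ := by linarith
      exact le_of_mul_le_mul_left this (ht0 k)
    have e4 : (φ (u k)).toReal + ⟪g, x0 - u k⟫ + r * ‖g‖ ≤ (φ x0).toReal + 1 := by
      by_cases hg0 : g = 0
      · have hh := hball (x := x0) (by simp [hr.le])
        have := phi_grad hφ (hui k) hh.1
        rw [← hg, hg0] at this
        rw [hg0]; simp at this ⊢; linarith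
      · have hgn : 0 < ‖g‖ := norm_pos_iff.2 hg0
        have hh := hball (x := x0 + (r / ‖g‖) • g) (by
          simp [norm_smul, abs_of_pos hr, hgn.ne'])
        have h7 := phi_grad hφ (hui k) hh.1
        have h8 : ⟪g, x0 + (r / ‖g‖) • g - u k⟫ = ⟪g, x0 - u k⟫ + r * ‖g‖ := by
          rw [show x0 + (r / ‖g‖) • g - u k = (x0 - u k) + (r / ‖g‖) • g by abel,
            inner_add_right, inner_smul_right, real_inner_self_eq_norm_sq]
          field_simp
        rw [← hg, h8] at h7
        linarith [hh.2]
    rw [huk3, inner_smul_right] at e4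
    have a1 := abs_le.1 (le_refl |α|)
    have a2 : (1 - t k) * α ≤ (1 - t k) * ⟪g, x0 - xh⟫ :=
      mul_le_mul_of_nonneg_left e3 (by linarith [ht1 k])
    have a3 : - |α| ≤ t k * α := by nlinarith [ht0 k, ht1 k, abs_nonneg α]
    have a4 : - |α| ≤ (1 - t k) * α := by nlinarith [ht0 k, ht1 k, abs_nonneg α]
    linarith
  obtain ⟨k, hk⟩ := (hinf.eventually (eventually_gt_atTop
    (((φ x0).toReal + 1 - (φ xh).toReal + 2 * |α|) / r))).exists
  rw [div_lt_iff₀ hr] at hk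
  linarith [hbd k]

/-- Real-valued summary of the facts on `φ` and its conjugate. -/
lemma conj_of_sub {Z : Set (Eucl n)} {f : Eucl n → EReal} (hbot : ∀ y ∈ Z, f y ≠ ⊥)
    {p g : Eucl n} (hp : p ∈ Z) (hpt : f p ≠ ⊤) (hg : g ∈ fsubdiff Z f p) :
    fconj (cExt Z f) g = ((⟪p, g⟫ - (f p).toReal : ℝ) : EReal) := by
  apply le_antisymm
  · refine iSup_le fun y => ?_
    by_cases hy : y ∈ Z
    · simp only [cExt, if_pos hy]
      by_cases hyt : f y = ⊤
      · rw [hyt]; simp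
      · have := sub_real hg hp hy hpt hyt hbot
        rw [inner_sub_right] at this
        rw [coe_tr hyt (hbot y hy)]
        have h2 : ⟪y, g⟫ - (f y).toReal ≤ ⟪p, g⟫ - (f p).toReal := by
          rw [real_inner_comm g y, real_inner_comm g p]; linarith
        exact_mod_cast h2
    · simp [cExt, if_neg hy]
  · refine le_trans ?_ (le_iSup _ p)
    simp only [cExt, if_pos hp]
    conv_rhs => rw [coe_tr hpt (hbot p hp)]
    exact_mod_cast le_refl _

lemma cExt_edom : cExt (edom φ) φ = φ := by
  funext x
  simp only [cExt]
  split_ifs with h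
  · rfl
  · simpa [edom, eq_comm] using h

lemma phi_conj_at (hφ : IsDGF φ φ') {x u : Eucl n} (hx : x ∈ edom φ)
    (h : ∀ y ∈ edom φ, (φ x).toReal + ⟪u, y - x⟫ ≤ (φ y).toReal) :
    fconj φ u = ((⟪x, u⟫ - (φ x).toReal : ℝ) : EReal) := by
  have := conj_of_sub (Z := edom φ) (f := φ) (fun y _ => hφ.ne_bot y) hx hx
    (sub_of_real hx hx (fun y _ => hφ.ne_bot y) (fun y hy _ => h y hy))
  rwa [cExt_edom] at this

/-- `ps φ u` is the real value of the conjugate. -/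
lemma phi_conj_coe (hφ : IsDGF φ φ') (hco : OneCoercive φ) (u : Eucl n) :
    fconj φ u = (((fconj φ u).toReal : ℝ) : EReal) := by
  obtain ⟨x, hx, h⟩ := phi_attain hφ hco u
  rw [phi_conj_at hφ hx h, EReal.toReal_coe]

lemma phi_FY (hφ : IsDGF φ φ') (hco : OneCoercive φ) (u : Eucl n) {y : Eucl n}
    (hy : y ∈ edom φ) : ⟪y, u⟫ - (φ y).toReal ≤ (fconj φ u).toReal := by
  have h : ((⟪y, u⟫ : ℝ) : EReal) - φ y ≤ fconj φ u :=
    le_iSup (fun x : Eucl n => ((⟪x, u⟫ : ℝ) : EReal) - φ x) y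
  rw [phi_conj_coe hφ hco u, coe_tr hy (hφ.ne_bot y)] at h
  exact_mod_cast h

lemma phi_conj_grad (hφ : IsDGF φ φ') {x : Eucl n} (hx : x ∈ interior (edom φ)) :
    (fconj φ (φ' x)).toReal = ⟪x, φ' x⟫ - (φ x).toReal := by
  rw [phi_conj_at hφ (interior_subset hx) (fun y hy => phi_grad hφ hx hy), EReal.toReal_coe]

lemma phi_surj (hφ : IsDGF φ φ') (hL : Legendre φ φ') (hco : OneCoercive φ) (u : Eucl n) :
    ∃ y ∈ interior (edom φ), (fconj φ u).toReal = ⟪y, u⟫ - (φ y).toReal := by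
  obtain ⟨x, hx, h⟩ := phi_attain hφ hco u
  exact ⟨x, phi_int hφ hL hx h, by rw [phi_conj_at hφ hx h, EReal.toReal_coe]⟩

lemma phis_eq (hφ : IsDGF φ φ') (hco : OneCoercive φ) {φs : Eucl n → Eucl n}
    (hφs : ∀ v : Eucl n, HasGradientAt (fun ξ => (fconj φ ξ).toReal) (φs v) v)
    {x : Eucl n} (hx : x ∈ interior (edom φ)) : φs (φ' x) = x := by
  refine grad_unique (hφs (φ' x)) (Eventually.of_forall fun u => ?_)
  rw [phi_conj_grad hφ hx, inner_sub_right]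
  linarith [phi_FY hφ hco u (interior_subset hx)]

end phi

lemma lower_bdd {X : Set (Eucl n)} {f : Eucl n → EReal}
    (hlsc : LowerSemicontinuousOn f X) (hbot : ∀ y ∈ X, f y ≠ ⊥) {y : Eucl n} {r : ℝ}
    (hball : Metric.closedBall y r ⊆ X) : ∃ m : ℝ, ∀ p ∈ Metric.closedBall y r, (m : EReal) ≤ f p := by
  by_cases hne : (Metric.closedBall y r).Nonempty
  · obtain ⟨p, hp, hmin⟩ := lsc_min (isCompact_closedBall y r) hne (hlsc.mono hball)
      (g := fun _ => 0) continuous_const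
    simp only [EReal.coe_zero, add_zero] at hmin
    refine ⟨(f p).toReal, fun q hq => le_trans ?_ (hmin q hq)⟩
    exact EReal.coe_toReal_le (hbot p (hball hp))
  · exact ⟨0, fun p hp => (hne ⟨p, hp⟩).elim⟩

lemma prox_pt {X : Set (Eucl n)} {f : Eucl n → EReal} (hconv : ConvexOnE X f)
    (hlsc : LowerSemicontinuousOn f X) (hbot : ∀ y ∈ X, f y ≠ ⊥) {y z : Eucl n} {r : ℝ}
    (hball : Metric.closedBall y r ⊆ X) (hz : dist z y < r) (hzt : f z ≠ ⊤) :
    ∃ K0 : ℝ, ∀ K ≥ K0, ∃ p, dist p y < r ∧ f p ≠ ⊤ ∧ (-K) • (p - y) ∈ fsubdiff X f p := by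
  obtain ⟨m, hm⟩ := lower_bdd hlsc hbot hball
  have hr : 0 < r := dist_nonneg.trans_lt hz
  have hzK : z ∈ Metric.closedBall y r := hz.le
  have hzX := hball hzK
  set d := dist z y with hd
  have hd0 : 0 ≤ d := dist_nonneg
  have hgap : 0 < r ^ 2 - d ^ 2 := by nlinarith
  set b := (f z).toReal with hb
  refine ⟨max 1 (2 * (b - m) / (r ^ 2 - d ^ 2) + 1), fun K hK => ?_⟩
  have hK1 : 1 ≤ K := (le_max_left _ _).trans hK
  have hK2 : 2 * (b - m) < K * (r ^ 2 - d ^ 2) := by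
    rw [← div_lt_iff₀ hgap]
    linarith [(le_max_right 1 (2 * (b - m) / (r ^ 2 - d ^ 2) + 1)).trans hK]
  obtain ⟨p, hp, hmin⟩ := lsc_min (isCompact_closedBall y r) ⟨z, hzK⟩ (hlsc.mono hball)
    (g := fun q => K / 2 * ‖q - y‖ ^ 2) (by fun_prop)
  have hpX := hball hp
  have h1 := hmin z hzK
  rw [coe_tr hzt (hbot z hzX), ← EReal.coe_add] at h1
  have hpt : f p ≠ ⊤ := by
    intro h
    rw [h, EReal.top_add_coe, top_le_iff] at h1
    exact EReal.coe_ne_top _ h1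
  have h2 := hm p hp
  rw [coe_tr hpt (hbot p hpX)] at h1 h2
  have h1 : (f p).toReal + K / 2 * ‖p - y‖ ^ 2 ≤ b + K / 2 * ‖z - y‖ ^ 2 := by exact_mod_cast h1
  have h2 : m ≤ (f p).toReal := by exact_mod_cast h2
  rw [← dist_eq_norm z y, ← hd] at h1
  have hpr : dist p y < r := by
    rw [dist_eq_norm]
    have : K * ‖p - y‖ ^ 2 < K * r ^ 2 := by nlinarith
    have : ‖p - y‖ ^ 2 < r ^ 2 := lt_of_mul_lt_mul_left this (by linarith)
    exact lt_of_pow_lt_pow_left₀ 2 hr.le this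
  refine ⟨p, hpr, hpt, ?_⟩
  refine support_global hconv hpX (coe_tr hpt (hbot p hpX)) fun ε hε => ?_
  have e1 : ∀ᶠ q in 𝓝 p, q ∈ Metric.ball y r := Metric.isOpen_ball.mem_nhds hpr
  have e2 : ∀ᶠ q in 𝓝 p, q ∈ Metric.ball p (2 * ε / K) :=
    Metric.ball_mem_nhds _ (by positivity)
  filter_upwards [e1, e2] with q hq1 hq2
  have hqK : q ∈ Metric.closedBall y r := Metric.ball_subset_closedBall hq1
  have h3 := hmin q hqK
  by_cases hqt : f q = ⊤
  · rw [hqt]; exact le_top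
  rw [coe_tr hpt (hbot p hpX), coe_tr hqt (hbot q (hball hqK))] at h3
  rw [coe_tr hqt (hbot q (hball hqK))]
  have h3 : (f p).toReal + K / 2 * ‖p - y‖ ^ 2 ≤ (f q).toReal + K / 2 * ‖q - y‖ ^ 2 := by
    exact_mod_cast h3
  have h4 : ‖q - y‖ ^ 2 = ‖p - y‖ ^ 2 + 2 * ⟪p - y, q - p⟫ + ‖q - p‖ ^ 2 := by
    rw [← norm_add_sq_real]; congr 2; abel
  have h5 : ‖q - p‖ < 2 * ε / K := by rw [← dist_eq_norm]; exact hq2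
  rw [lt_div_iff₀ (by linarith)] at h5
  have h6 : K / 2 * ‖q - p‖ ^ 2 ≤ ε * ‖q - p‖ := by nlinarith [norm_nonneg (q - p)]
  have : (f p).toReal + ⟪(-K) • (p - y), q - p⟫ - ε * ‖q - p‖ ≤ (f q).toReal := by
    rw [inner_smul_left]
    simp only [conj_trivial]
    rw [h4] at h3
    nlinarith
  exact_mod_cast this

lemma exists_sub_pt {X : Set (Eucl n)} {f : Eucl n → EReal} (hconv : ConvexOnE X f)
    (hlsc : LowerSemicontinuousOn f X) (hbot : ∀ y ∈ X, f y ≠ ⊥)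
    (hex : ∃ x ∈ interior X, f x ≠ ⊤) :
    ∃ p ∈ interior X, f p ≠ ⊤ ∧ (fsubdiff X f p).Nonempty := by
  obtain ⟨x, hx, hxt⟩ := hex
  obtain ⟨r, hr, hball⟩ := Metric.nhds_basis_closedBall.mem_iff.1 (isOpen_interior.mem_nhds hx)
  obtain ⟨K, hK⟩ := prox_pt hconv hlsc hbot (hball.trans interior_subset)
    (z := x) (by simpa using hr) hxt
  obtain ⟨p, hp, hpt, hs⟩ := hK K le_rfl
  exact ⟨p, hball hp.le, hpt, _, hs⟩

lemma FM_local {X : Set (Eucl n)} {f : Eucl n → EReal} (hconv : ConvexOnE X f)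
    (hlsc : LowerSemicontinuousOn f X) (hbot : ∀ y ∈ X, f y ≠ ⊥)
    {M : ℝ} {y z : Eucl n} {r : ℝ} (hM : ∀ p ∈ interior X, f p ≠ ⊤ → ∀ ξ ∈ fsubdiff X f p,
      (f p).toReal + ⟪ξ, y - p⟫ ≤ M)
    (hball : Metric.closedBall y r ⊆ interior X) (hz : dist z y < r) (hzt : f z ≠ ⊤) :
    f y ≤ (M : EReal) := by
  by_contra hcon
  rw [not_le] at hcon
  have hr : 0 < r := dist_nonneg.trans_lt hz
  have hyi : y ∈ interior X := hball (Metric.mem_closedBall_self hr.le)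
  have hev := hlsc y (interior_subset hyi) _ hcon
  rw [nhdsWithin_eq_nhds.2 (mem_interior_iff_mem_nhds.1 hyi)] at hev
  obtain ⟨δ, hδ, hδb⟩ := Metric.eventually_nhds_iff.1 hev
  have hb2 := hball.trans interior_subset
  obtain ⟨m, hm⟩ := lower_bdd hlsc hbot hb2
  obtain ⟨K0, hK0⟩ := prox_pt hconv hlsc hbot hb2 hz hzt
  set K := max K0 (max 1 ((M - m) / δ ^ 2 + 1)) with hK
  obtain ⟨p, hp, hpt, hs⟩ := hK0 K (le_max_left _ _)
  have hK1 : 1 ≤ K := (le_max_left _ _).trans (le_max_right _ _)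
  have hK2 : M - m < K * δ ^ 2 := by
    rw [← div_lt_iff₀ (by positivity)]
    linarith [(le_max_right (1:ℝ) ((M - m) / δ ^ 2 + 1)).trans (le_max_right K0 _)]
  have hpi : p ∈ interior X := hball hp.le
  have h1 := hM p hpi hpt _ hs
  have h2 : ⟪(-K) • (p - y), y - p⟫ = K * ‖p - y‖ ^ 2 := by
    rw [show y - p = - (p - y) by abel, inner_smul_left, inner_neg_right,
      real_inner_self_eq_norm_sq]
    simp
  rw [h2] at h1
  have h3 : δ ≤ dist p y := by
    by_contra h
    have h4 : (M : EReal) < f p := hδb (not_le.1 h)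
    rw [coe_tr hpt (hbot p (interior_subset hpi))] at h4
    have h4 : M < (f p).toReal := by exact_mod_cast h4
    nlinarith [sq_nonneg ‖p - y‖]
  have h5 := hm p hp.le
  rw [coe_tr hpt (hbot p (interior_subset hpi))] at h5
  have h5 : m ≤ (f p).toReal := by exact_mod_cast h5
  rw [dist_eq_norm] at h3
  have h6 : δ ^ 2 ≤ ‖p - y‖ ^ 2 := pow_le_pow_left₀ hδ.le h3 2
  nlinarith

lemma FM {X : Set (Eucl n)} {f : Eucl n → EReal} (hX : Convex ℝ X) (hconv : ConvexOnE X f)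
    (hlsc : LowerSemicontinuousOn f X) (hbot : ∀ y ∈ X, f y ≠ ⊥)
    (hex : ∃ x ∈ interior X, f x ≠ ⊤)
    {M : Eucl n → ℝ} (hM : ∀ p ∈ interior X, f p ≠ ⊤ → ∀ ξ ∈ fsubdiff X f p,
      ∀ y ∈ interior X, (f p).toReal + ⟪ξ, y - p⟫ ≤ M y) :
    ∀ y ∈ interior X, f y ≤ (M y : EReal) := by
  have loc : ∀ y r z, Metric.closedBall y r ⊆ interior X → dist z y < r → f z ≠ ⊤ →
      f y ≤ (M y : EReal) := by
    intro y r z hball hz hzt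
    exact FM_local hconv hlsc hbot (fun p hp hpt ξ hξ => hM p hp hpt ξ hξ y
      (hball (Metric.mem_closedBall_self (dist_nonneg.trans hz.le)))) hball hz hzt
  set u : Set (Eucl n) := {y | y ∈ interior X ∧ f y ≠ ⊤} with hu
  have huo : IsOpen u := by
    rw [Metric.isOpen_iff]
    rintro z ⟨hz, hzt⟩
    obtain ⟨r, hr, hball⟩ := Metric.nhds_basis_closedBall.mem_iff.1 (isOpen_interior.mem_nhds hz)
    refine ⟨r / 2, by positivity, fun y hy => ?_⟩
    have hyz : dist y z < r / 2 := hy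
    have hb : Metric.closedBall y (r / 2) ⊆ interior X :=
      (Metric.closedBall_subset_closedBall' (by linarith)).trans hball
    refine ⟨hb (Metric.mem_closedBall_self (by positivity)), ?_⟩
    have := loc y (r / 2) z hb (by rwa [dist_comm]) hzt
    exact (this.trans_lt (EReal.coe_lt_top _)).ne
  have hcl : ∀ y ∈ interior X, y ∈ closure u → f y ≤ (M y : EReal) := by
    intro y hy hyc
    obtain ⟨r, hr, hball⟩ := Metric.nhds_basis_closedBall.mem_iff.1 (isOpen_interior.mem_nhds hy)
    obtain ⟨z, hz, hzy⟩ := Metric.mem_closure_iff.1 hyc r hr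
    exact loc y r z hball (by rwa [dist_comm]) hz.2
  have hsub : interior X ⊆ u := by
    refine hX.interior.isPreconnected.subset_of_closure_inter_subset huo ?_ ?_
    · obtain ⟨x, hx, hxt⟩ := hex
      exact ⟨x, hx, hx, hxt⟩
    · rintro y ⟨hyc, hy⟩
      exact ⟨hy, ((hcl y hy hyc).trans_lt (EReal.coe_lt_top _)).ne⟩
  exact fun y hy => hcl y hy (subset_closure (hsub hy))

lemma exists_sub {X : Set (Eucl n)} {f : Eucl n → EReal} (hX : Convex ℝ X)
    (hconv : ConvexOnE X f) (hbot : ∀ y ∈ X, f y ≠ ⊥)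
    (hfin : ∀ x ∈ interior X, f x ≠ ⊤) {x : Eucl n} (hx : x ∈ interior X) :
    (fsubdiff X f x).Nonempty := by
  have hF : ConvexOn ℝ (interior X) (fun z => (f z).toReal) := by
    refine ⟨hX.interior, fun y hy z hz a b ha hb hab => ?_⟩
    have h := convE_le hconv (interior_subset hy) (interior_subset hz) ha hb hab
      (EReal.le_coe_toReal (hfin y hy)) (EReal.le_coe_toReal (hfin z hz))
    have hm := hX.interior hy hz ha hb hab
    rw [coe_tr (hfin _ hm) (hbot _ (interior_subset hm))] at h
    exact_mod_cast h
  obtain ⟨a, ha⟩ := exists_subgrad_real isOpen_interior hF hx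
  refine ⟨a, support_global hconv (interior_subset hx)
    (coe_tr (hfin x hx) (hbot x (interior_subset hx))) fun ε hε => ?_⟩
  filter_upwards [isOpen_interior.mem_nhds hx] with y hy
  rw [coe_tr (hfin y hy) (hbot y (interior_subset hy))]
  have h1 := ha y hy
  have h2 : 0 ≤ ε * ‖y - x‖ := by positivity
  exact_mod_cast by linarith

/-- Support-function form of relative smoothness. -/
def UU (φ : Eucl n → EReal) (φ' : Eucl n → Eucl n) (f : Eucl n → EReal) : Prop :=
  ∀ x ∈ interior (edom φ), f x ≠ ⊤ ∧ ∃ a ∈ fsubdiff (edom φ) f x, ∀ y ∈ interior (edom φ),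
    (f y).toReal ≤ (f x).toReal + ⟪a, y - x⟫ + ((φ y).toReal - (φ x).toReal - ⟪φ' x, y - x⟫)

section main

variable {φ : Eucl n → EReal} {φ' : Eucl n → Eucl n} {f : Eucl n → EReal}

lemma UU_spec (hφ : IsDGF φ φ') (hbot : ∀ x ∈ edom φ, f x ≠ ⊥) (h : UU φ φ' f) :
    ∃ f' : Eucl n → Eucl n, ∀ x ∈ interior (edom φ), f x ≠ ⊤ ∧
      HasGradientAt (fun z => (f z).toReal) (f' x) x ∧ f' x ∈ fsubdiff (edom φ) f x ∧
      ∀ y ∈ interior (edom φ), (f y).toReal ≤ (f x).toReal + ⟪f' x, y - x⟫ +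
        ((φ y).toReal - (φ x).toReal - ⟪φ' x, y - x⟫) := by
  have h2 : ∀ x, ∃ a, x ∈ interior (edom φ) → a ∈ fsubdiff (edom φ) f x ∧
      ∀ y ∈ interior (edom φ), (f y).toReal ≤ (f x).toReal + ⟪a, y - x⟫ +
        ((φ y).toReal - (φ x).toReal - ⟪φ' x, y - x⟫) := by
    intro x
    by_cases hx : x ∈ interior (edom φ)
    · obtain ⟨_, a, ha, hb⟩ := h x hx
      exact ⟨a, fun _ => ⟨ha, hb⟩⟩
    · exact ⟨0, fun hx' => (hx hx').elim⟩
  choose f' hf' using h2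
  refine ⟨f', fun x hx => ⟨(h x hx).1, grad_of_eps fun ε hε => ?_, (hf' x hx).1, (hf' x hx).2⟩⟩
  filter_upwards [grad_eps (hφ.diff x hx) hε, isOpen_interior.mem_nhds hx] with y hy hyi
  have h1 := (hf' x hx).2 y hyi
  have h3 := sub_real (hf' x hx).1 (interior_subset hx) (interior_subset hyi) (h x hx).1
    (h y hyi).1 hbot
  have h4 := abs_le.1 hy
  rw [abs_le]
  have : 0 ≤ ε * ‖y - x‖ := by positivity
  constructor <;> linarith

lemma UU_conv (hφ : IsDGF φ φ') (hbot : ∀ x ∈ edom φ, f x ≠ ⊥) (h : UU φ φ' f) :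
    ConvexOnE (interior (edom φ)) (fun x => φ x - f x) := by
  have hc : ∀ x ∈ interior (edom φ), φ x - f x = (((φ x).toReal - (f x).toReal : ℝ) : EReal) := by
    intro x hx
    conv_lhs => rw [coe_tr (interior_subset hx) (hφ.ne_bot x),
      coe_tr (h x hx).1 (hbot x (interior_subset hx))]
    rw [EReal.coe_sub]
  intro x hx y hy a b ha hb hab
  have hw := (convex_edom hφ.convex).interior hx hy ha hb hab
  set w := a • x + b • y with hwd
  simp only
  rw [hc w hw, hc x hx, hc y hy]
  obtain ⟨_, g, _, hg⟩ := h w hw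
  have h1 := hg x hx
  have h2 := hg y hy
  have e : ∀ v : Eucl n, a * ⟪v, x - w⟫ + b * ⟪v, y - w⟫ = 0 := by
    intro v
    rw [← inner_smul_right, ← inner_smul_right, ← inner_add_right]
    have : a • (x - w) + b • (y - w) = 0 := by
      rw [smul_sub, smul_sub, show a • x - a • w + (b • y - b • w) = (a • x + b • y) - (a + b) • w by
        rw [add_smul]; abel, hab, one_smul, hwd, sub_self]
    rw [this, inner_zero_right]
  have e1 := e g
  have e2 := e (φ' w)
  have h3 := mul_le_mul_of_nonneg_left h1 ha
  have h4 := mul_le_mul_of_nonneg_left h2 hb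
  have e3 : a * (f w).toReal + b * (f w).toReal = (f w).toReal := by rw [← add_mul, hab, one_mul]
  have e4 : a * (φ w).toReal + b * (φ w).toReal = (φ w).toReal := by rw [← add_mul, hab, one_mul]
  have : (φ w).toReal - (f w).toReal ≤
      a * ((φ x).toReal - (f x).toReal) + b * ((φ y).toReal - (f y).toReal) := by
    nlinarith
  exact_mod_cast this

lemma fin_of_conv (hφ : IsDGF φ φ') (hbot : ∀ x ∈ edom φ, f x ≠ ⊥)
    (hex : ∃ x ∈ interior (edom φ), f x ≠ ⊤)
    (hc : ConvexOnE (interior (edom φ)) (fun x => φ x - f x)) :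
    ∀ x ∈ interior (edom φ), f x ≠ ⊤ := by
  intro y hy hyt
  obtain ⟨x, hx, hxt⟩ := hex
  have htend : Tendsto (fun t : ℝ => x + t • (x - y)) (𝓝[>] 0) (𝓝 x) := by
    have : ContinuousAt (fun t : ℝ => x + t • (x - y)) 0 := by fun_prop
    have := this.tendsto
    simp only [zero_smul, add_zero] at this
    exact this.mono_left nhdsWithin_le_nhds
  obtain ⟨t, ht, ht0⟩ := ((htend.eventually (isOpen_interior.mem_nhds hx)).and
    self_mem_nhdsWithin).exists
  have ht0 : 0 < t := ht0
  have h := hc _ ht _ hy (1 / (1 + t)) (t / (1 + t)) (by positivity) (by positivity)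
    (by field_simp)
  have e : (1 / (1 + t)) • (x + t • (x - y)) + (t / (1 + t)) • y = x := by
    have : (1 + t) ≠ 0 := by positivity
    rw [smul_add, smul_smul, smul_sub]
    have h1 : (1 / (1 + t)) * t = t / (1 + t) := by ring
    rw [h1, add_assoc, sub_add_cancel, ← add_smul]
    have : 1 / (1 + t) + t / (1 + t) = 1 := by field_simp
    rw [this, one_smul]
  rw [e] at h
  simp only [hyt, EReal.sub_top] at h
  rw [EReal.coe_mul_bot_of_pos (by positivity), EReal.add_bot, le_bot_iff,
    coe_tr (interior_subset hx) (hφ.ne_bot x), coe_tr hxt (hbot x (interior_subset hx)),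
    ← EReal.coe_sub] at h
  exact EReal.coe_ne_bot _ h

lemma UU_of_conv (hφ : IsDGF φ φ') (hbot : ∀ x ∈ edom φ, f x ≠ ⊥)
    (hcvx : ConvexOnE (edom φ) f)
    (hfin : ∀ x ∈ interior (edom φ), f x ≠ ⊤)
    (hc : ConvexOnE (interior (edom φ)) (fun x => φ x - f x)) : UU φ φ' f := by
  have hco : ∀ x ∈ interior (edom φ), φ x - f x = (((φ x).toReal - (f x).toReal : ℝ) : EReal) := by
    intro x hx
    conv_lhs => rw [coe_tr (interior_subset hx) (hφ.ne_bot x),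
      coe_tr (hfin x hx) (hbot x (interior_subset hx))]
    rw [EReal.coe_sub]
  intro x hx
  obtain ⟨a, ha⟩ := exists_sub (convex_edom hφ.convex) hcvx hbot hfin hx
  refine ⟨hfin x hx, a, ha, ?_⟩
  have hs : φ' x - a ∈ fsubdiff (interior (edom φ)) (fun x => φ x - f x) x := by
    refine support_global hc hx (hco x hx) fun ε hε => ?_
    have htend : Tendsto (fun y : Eucl n => x + (x - y)) (𝓝 x) (𝓝 x) := by
      have : ContinuousAt (fun y : Eucl n => x + (x - y)) x := by fun_prop
      have := this.tendsto
      simpa using this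
    filter_upwards [isOpen_interior.mem_nhds hx, htend.eventually (isOpen_interior.mem_nhds hx),
      htend.eventually (grad_eps (hφ.diff x hx) hε)] with y hy hy2 hgr
    rw [hco y hy]
    have h1 := convE_le hc hy hy2 (a := 1/2) (b := 1/2) (by norm_num) (by norm_num) (by norm_num)
      (hco y hy).le (hco _ hy2).le
    have e : (1/2 : ℝ) • y + (1/2 : ℝ) • (x + (x - y)) = x := by module
    rw [e, hco x hx] at h1
    have h1 : (φ x).toReal - (f x).toReal ≤ 1/2 * ((φ y).toReal - (f y).toReal) +
      1/2 * ((φ (x + (x - y))).toReal - (f (x + (x - y))).toReal) := by exact_mod_cast h1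
    have h2 := sub_real ha (interior_subset hx) (interior_subset hy2) (hfin x hx)
      (hfin _ hy2) hbot
    have h3 := (abs_le.1 hgr).2
    have e2 : x + (x - y) - x = - (y - x) := by abel
    rw [e2, inner_neg_right] at h2 h3
    rw [norm_neg] at h3
    have : (φ x).toReal - (f x).toReal + ⟪φ' x - a, y - x⟫ - ε * ‖y - x‖ ≤
      (φ y).toReal - (f y).toReal := by
      rw [inner_sub_left]; linarith
    exact_mod_cast this
  intro y hy
  have h1 := hs y hy
  simp only [hco x hx, hco y hy] at h1
  have h1 : (φ x).toReal - (f x).toReal + ⟪φ' x - a, y - x⟫ ≤ (φ y).toReal - (f y).toReal := by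
    exact_mod_cast h1
  rw [inner_sub_left] at h1
  linarith

lemma UU_of_V (hφ : IsDGF φ φ') (hbot : ∀ x ∈ edom φ, f x ≠ ⊥)
    (hlsc : LowerSemicontinuousOn f (edom φ))
    (hcvx : ConvexOnE (edom φ) f) (hex : ∃ x ∈ interior (edom φ), f x ≠ ⊤)
    (hV : ∀ x ∈ interior (edom φ), f x ≠ ⊤ → (fsubdiff (edom φ) f x).Nonempty →
      ∃ a ∈ fsubdiff (edom φ) f x, ∀ p ∈ interior (edom φ), f p ≠ ⊤ →
        ∀ ξ ∈ fsubdiff (edom φ) f p, ∀ y ∈ interior (edom φ),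
        (f p).toReal + ⟪ξ, y - p⟫ ≤ (f x).toReal + ⟪a, y - x⟫ +
          ((φ y).toReal - (φ x).toReal - ⟪φ' x, y - x⟫)) : UU φ φ' f := by
  have hX := convex_edom hφ.convex
  have hfin : ∀ x ∈ interior (edom φ), f x ≠ ⊤ := by
    obtain ⟨p, hp, hpt, hps⟩ := exists_sub_pt hcvx hlsc hbot hex
    obtain ⟨a, _, ha⟩ := hV p hp hpt hps
    intro y hy
    exact ((FM hX hcvx hlsc hbot hex ha y hy).trans_lt (EReal.coe_lt_top _)).ne
  intro x hx
  refine ⟨hfin x hx, ?_⟩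
  obtain ⟨a, ha, hb⟩ := hV x hx (hfin x hx) (exists_sub hX hcvx hbot hfin hx)
  refine ⟨a, ha, fun y hy => ?_⟩
  have h1 := FM hX hcvx hlsc hbot hex hb y hy
  rw [coe_tr (hfin y hy) (hbot y (interior_subset hy))] at h1
  exact_mod_cast h1

lemma Dstar_coe (hφ : IsDGF φ φ') (hco : OneCoercive φ) {φs : Eucl n → Eucl n}
    (hφs : ∀ v : Eucl n, HasGradientAt (fun ξ => (fconj φ ξ).toReal) (φs v) v)
    {x : Eucl n} (hx : x ∈ interior (edom φ)) (u : Eucl n) :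
    fconj φ u - fconj φ (φ' x) - ((⟪φs (φ' x), u - φ' x⟫ : ℝ) : EReal) =
    (((fconj φ u).toReal - ⟪x, u⟫ + (φ x).toReal : ℝ) : EReal) := by
  rw [phis_eq hφ hco hφs hx]
  conv_lhs => rw [phi_conj_coe hφ hco u, phi_conj_coe hφ hco (φ' x), phi_conj_grad hφ hx]
  rw [← EReal.coe_sub, ← EReal.coe_sub, inner_sub_right]
  congr 1; ring

/-- The cocoercivity inequality implies the support inequality. -/
lemma V_of_coco (hφ : IsDGF φ φ') (hco : OneCoercive φ) {x p a ξ y : Eucl n}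
    (hy : y ∈ interior (edom φ))
    (h : (fconj φ (φ' x - (a - ξ))).toReal - ⟪x, φ' x - (a - ξ)⟫ + (φ x).toReal ≤
      (f x).toReal - (f p).toReal - ⟪ξ, x - p⟫) :
    (f p).toReal + ⟪ξ, y - p⟫ ≤ (f x).toReal + ⟪a, y - x⟫ +
          ((φ y).toReal - (φ x).toReal - ⟪φ' x, y - x⟫) := by
  have h1 := phi_FY hφ hco (φ' x - (a - ξ)) (interior_subset hy)
  simp only [inner_sub_right, inner_sub_left, real_inner_comm] at h1 h ⊢
  simp only [real_inner_comm y, real_inner_comm x, real_inner_comm p] at h1 h ⊢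
  linarith

/-- Support inequality implies the cocoercivity inequality. -/
lemma coco_of_supp (hφ : IsDGF φ φ') (hL : Legendre φ φ') (hco : OneCoercive φ)
    {x p a ξ : Eucl n}
    (h : ∀ y ∈ interior (edom φ), (f p).toReal + ⟪ξ, y - p⟫ ≤ (f x).toReal + ⟪a, y - x⟫ +
          ((φ y).toReal - (φ x).toReal - ⟪φ' x, y - x⟫)) :
    (fconj φ (φ' x - (a - ξ))).toReal - ⟪x, φ' x - (a - ξ)⟫ + (φ x).toReal ≤
      (f x).toReal - (f p).toReal - ⟪ξ, x - p⟫ := by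
  obtain ⟨y, hy, hyu⟩ := phi_surj hφ hL hco (φ' x - (a - ξ))
  have h := h y hy
  rw [hyu]
  simp only [inner_sub_right, inner_sub_left] at h ⊢
  simp only [real_inner_comm y, real_inner_comm x, real_inner_comm p] at h ⊢
  linarith

end main

section main2

variable {φ : Eucl n → EReal} {φ' : Eucl n → Eucl n} {f : Eucl n → EReal}

lemma sub_ne_top {X : Set (Eucl n)} (hex : ∃ x ∈ X, f x ≠ ⊤) {x ξ : Eucl n}
    (hξ : ξ ∈ fsubdiff X f x) : f x ≠ ⊤ := by
  intro h
  obtain ⟨z, hz, hzt⟩ := hex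
  have := hξ z hz
  rw [h, EReal.top_add_coe, top_le_iff] at this
  exact hzt this

lemma sub_eq_grad {X : Set (Eucl n)} (hbot : ∀ x ∈ X, f x ≠ ⊥)
    (hfin : ∀ x ∈ interior X, f x ≠ ⊤) {x g ξ : Eucl n} (hx : x ∈ interior X)
    (hg : HasGradientAt (fun z => (f z).toReal) g x) (hξ : ξ ∈ fsubdiff X f x) : g = ξ := by
  refine grad_unique hg ?_
  filter_upwards [isOpen_interior.mem_nhds hx] with y hy
  exact sub_real hξ (interior_subset hx) (interior_subset hy) (hfin x hx) (hfin y hy) hbot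

lemma conj_ge {X : Set (Eucl n)} (hbot : ∀ x ∈ X, f x ≠ ⊥) {y : Eucl n} (hy : y ∈ X)
    (hyt : f y ≠ ⊤) (ξ : Eucl n) :
    ((⟪y, ξ⟫ - (f y).toReal : ℝ) : EReal) ≤ fconj (cExt X f) ξ := by
  refine le_trans ?_ (le_iSup _ y)
  simp only [cExt, if_pos hy]
  conv_rhs => rw [coe_tr hyt (hbot y hy)]
  exact_mod_cast le_refl _

lemma coco_E_to_real (hφ : IsDGF φ φ') (hco : OneCoercive φ) {φs : Eucl n → Eucl n}
    (hφs : ∀ v : Eucl n, HasGradientAt (fun ξ => (fconj φ ξ).toReal) (φs v) v)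
    (hbot : ∀ x ∈ edom φ, f x ≠ ⊥) {x p u : Eucl n} {c : ℝ}
    (hx : x ∈ interior (edom φ)) (hp : p ∈ edom φ) (hxt : f x ≠ ⊤) (hpt : f p ≠ ⊤) :
    fconj φ u - fconj φ (φ' x) - ((⟪φs (φ' x), u - φ' x⟫ : ℝ) : EReal) ≤
      f x - f p - (c : EReal) ↔
    (fconj φ u).toReal - ⟪x, u⟫ + (φ x).toReal ≤ (f x).toReal - (f p).toReal - c := by
  rw [Dstar_coe hφ hco hφs hx]
  conv_lhs => rw [coe_tr hxt (hbot x (interior_subset hx)), coe_tr hpt (hbot p hp)]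
  rw [← EReal.coe_sub, ← EReal.coe_sub, EReal.coe_le_coe_iff]

lemma UU_coco (hφ : IsDGF φ φ') (hL : Legendre φ φ') (hco : OneCoercive φ) {φs : Eucl n → Eucl n}
    (hφs : ∀ v : Eucl n, HasGradientAt (fun ξ => (fconj φ ξ).toReal) (φs v) v)
    (hbot : ∀ x ∈ edom φ, f x ≠ ⊥) (hex : ∃ x ∈ interior (edom φ), f x ≠ ⊤)
    (h : UU φ φ' f) :
    ∃ f' : Eucl n → Eucl n,
      (∀ x ∈ interior (edom φ), HasGradientAt (fun z => (f z).toReal) (f' x) x ∧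
        f' x ∈ fsubdiff (edom φ) f x) ∧
      ∀ xb ∈ interior (edom φ), ∀ x ∈ edom φ, ∀ ξ ∈ fsubdiff (edom φ) f x,
        fconj φ (φ' xb - (f' xb - ξ)) - fconj φ (φ' xb) -
          ((⟪φs (φ' xb), φ' xb - (f' xb - ξ) - φ' xb⟫ : ℝ) : EReal) ≤
          f xb - f x - ((⟪ξ, xb - x⟫ : ℝ) : EReal) := by
  obtain ⟨f', hf'⟩ := UU_spec hφ hbot h
  refine ⟨f', fun x hx => ⟨(hf' x hx).2.1, (hf' x hx).2.2.1⟩, fun xb hxb x hx ξ hξ => ?_⟩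
  have hxt : f x ≠ ⊤ := by
    obtain ⟨z, hz, hzt⟩ := hex
    exact sub_ne_top ⟨z, interior_subset hz, hzt⟩ hξ
  rw [coco_E_to_real hφ hco hφs hbot hxb hx (hf' xb hxb).1 hxt]
  refine coco_of_supp hφ hL hco fun y hy => ?_
  exact (sub_real hξ hx (interior_subset hy) hxt (hf' y hy).1 hbot).trans ((hf' xb hxb).2.2.2 y hy)

lemma C_UU (hφ : IsDGF φ φ') (hco : OneCoercive φ) {φs : Eucl n → Eucl n}
    (hφs : ∀ v : Eucl n, HasGradientAt (fun ξ => (fconj φ ξ).toReal) (φs v) v)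
    (hbot : ∀ x ∈ edom φ, f x ≠ ⊥) (hlsc : LowerSemicontinuousOn f (edom φ))
    (hcvx : ConvexOnE (edom φ) f) (hex : ∃ x ∈ interior (edom φ), f x ≠ ⊤)
    {f' : Eucl n → Eucl n}
    (hf' : ∀ x ∈ interior (edom φ), HasGradientAt (fun z => (f z).toReal) (f' x) x)
    (h : ∀ xb ∈ interior (edom φ), ∀ x ∈ interior (edom φ), ∀ ξ ∈ fsubdiff (edom φ) f x,
        fconj φ (φ' xb - (f' xb - ξ)) - fconj φ (φ' xb) -
          ((⟪φs (φ' xb), φ' xb - (f' xb - ξ) - φ' xb⟫ : ℝ) : EReal) ≤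
          f xb - f x - ((⟪ξ, xb - x⟫ : ℝ) : EReal)) : UU φ φ' f := by
  refine UU_of_V hφ hbot hlsc hcvx hex fun x hx hxt _ => ?_
  refine ⟨f' x, grad_sub hcvx hx hxt hbot (hf' x hx), fun p hp hpt ξ hξ y hy => ?_⟩
  have h1 := h x hx p hp ξ hξ
  rw [coco_E_to_real hφ hco hφs hbot hx (interior_subset hp) hxt hpt] at h1
  exact V_of_coco hφ hco hy h1

lemma E_UU (hφ : IsDGF φ φ') (hco : OneCoercive φ) {φs : Eucl n → Eucl n}
    (hφs : ∀ v : Eucl n, HasGradientAt (fun ξ => (fconj φ ξ).toReal) (φs v) v)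
    (hbot : ∀ x ∈ edom φ, f x ≠ ⊥) (hlsc : LowerSemicontinuousOn f (edom φ))
    (hcvx : ConvexOnE (edom φ) f) (hex : ∃ x ∈ interior (edom φ), f x ≠ ⊤)
    {f' : Eucl n → Eucl n}
    (hf' : ∀ x ∈ interior (edom φ), HasGradientAt (fun z => (f z).toReal) (f' x) x)
    (h : ∀ x ∈ interior (edom φ), ∀ xb ∈ interior (edom φ),
        fconj φ (φ' xb - (f' xb - f' x)) - fconj φ (φ' xb) -
          ((⟪φs (φ' xb), φ' xb - (f' xb - f' x) - φ' xb⟫ : ℝ) : EReal) ≤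
          f xb - f x - ((⟪f' x, xb - x⟫ : ℝ) : EReal)) : UU φ φ' f := by
  have hfin : ∀ x ∈ interior (edom φ), f x ≠ ⊤ := by
    intro x hx hxt
    obtain ⟨z, hz, hzt⟩ := hex
    have h1 := h x hx z hz
    rw [Dstar_coe hφ hco hφs hz, hxt, EReal.sub_top, EReal.bot_sub, le_bot_iff] at h1
    exact EReal.coe_ne_bot _ h1
  refine C_UU hφ hco hφs hbot hlsc hcvx hex hf' fun xb hxb x hx ξ hξ => ?_
  rw [← sub_eq_grad hbot hfin hx (hf' x hx) hξ]
  exact h x hx xb hxb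

lemma D_ineq (hφ : IsDGF φ φ') (hL : Legendre φ φ') (hco : OneCoercive φ)
    (hbot : ∀ x ∈ edom φ, f x ≠ ⊥) (hfin : ∀ x ∈ interior (edom φ), f x ≠ ⊤)
    {x a : Eucl n} (hx : x ∈ interior (edom φ))
    (h : ∀ y ∈ interior (edom φ), (f y).toReal ≤ (f x).toReal + ⟪a, y - x⟫ +
          ((φ y).toReal - (φ x).toReal - ⟪φ' x, y - x⟫)) (ξ : Eucl n) :
    ((⟪x, a⟫ - (f x).toReal + (fconj φ (ξ - a + φ' x)).toReal -
      (fconj φ (φ' x)).toReal : ℝ) : EReal) ≤ fconj (cExt (edom φ) f) ξ := by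
  obtain ⟨y, hy, hyu⟩ := phi_surj hφ hL hco (ξ - a + φ' x)
  refine le_trans ?_ (conj_ge hbot (interior_subset hy) (hfin y hy) ξ)
  rw [EReal.coe_le_coe_iff, hyu, phi_conj_grad hφ hx]
  have h1 := h y hy
  simp only [inner_sub_right, inner_add_right] at h1 ⊢
  simp only [real_inner_comm y, real_inner_comm x] at h1 ⊢
  linarith

lemma UU_D (hφ : IsDGF φ φ') (hL : Legendre φ φ') (hco : OneCoercive φ)
    (hbot : ∀ x ∈ edom φ, f x ≠ ⊥) (h : UU φ φ' f) :
    ∀ ξ ξb : Eucl n, ∀ xb ∈ fsubdiff Set.univ (fconj (cExt (edom φ) f)) ξb,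
      xb ∈ interior (edom φ) →
        fconj (cExt (edom φ) f) ξb + fconj φ (ξ - ξb + φ' xb) - fconj φ (φ' xb) ≤
          fconj (cExt (edom φ) f) ξ := by
  intro ξ ξb x hxs hx
  obtain ⟨f', hf'⟩ := UU_spec hφ hbot h
  have hfin : ∀ x ∈ interior (edom φ), f x ≠ ⊤ := fun x hx => (hf' x hx).1
  obtain ⟨hxt, hg, hs, hS⟩ := hf' x hx
  have hxX := interior_subset hx
  have h1 := hxs (f' x) (mem_univ _)
  rw [conj_of_sub hbot hxX hxt hs] at h1
  have h2 := conj_ge hbot hxX hxt ξb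
  have h3 : fconj (cExt (edom φ) f) ξb = ((⟪x, ξb⟫ - (f x).toReal : ℝ) : EReal) := by
    refine le_antisymm ?_ h2
    have h4 := EReal.le_sub_iff_add_le (a := fconj (cExt (edom φ) f) ξb)
      (b := ((⟪x, f' x - ξb⟫ : ℝ) : EReal)) (c := ((⟪x, f' x⟫ - (f x).toReal : ℝ) : EReal))
      (Or.inl (EReal.coe_ne_bot _)) (Or.inl (EReal.coe_ne_top _))
    have h5 := h4.2 h1
    rw [← EReal.coe_sub] at h5
    refine h5.trans (EReal.coe_le_coe_iff.2 ?_)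
    rw [inner_sub_right]; linarith
  have h6 : ξb ∈ fsubdiff (edom φ) f x := by
    refine sub_of_real hxX hxt hbot fun y hy hyt => ?_
    have h7 := conj_ge hbot hy hyt ξb
    rw [h3, EReal.coe_le_coe_iff] at h7
    rw [inner_sub_right, real_inner_comm y, real_inner_comm x]
    linarith
  have h8 := sub_eq_grad hbot hfin hx hg h6
  rw [h8] at hS
  have h9 := D_ineq hφ hL hco hbot hfin hx hS ξ
  rw [h3, phi_conj_coe hφ hco (ξ - ξb + φ' x), phi_conj_coe hφ hco (φ' x)]
  exact_mod_cast h9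

lemma D_UU (hφ : IsDGF φ φ') (hco : OneCoercive φ)
    (hbot : ∀ x ∈ edom φ, f x ≠ ⊥) (hlsc : LowerSemicontinuousOn f (edom φ))
    (hcvx : ConvexOnE (edom φ) f) (hex : ∃ x ∈ interior (edom φ), f x ≠ ⊤)
    (h : ∀ ξ ξb : Eucl n, ∀ xb ∈ fsubdiff Set.univ (fconj (cExt (edom φ) f)) ξb,
      xb ∈ interior (edom φ) →
        fconj (cExt (edom φ) f) ξb + fconj φ (ξ - ξb + φ' xb) - fconj φ (φ' xb) ≤
          fconj (cExt (edom φ) f) ξ) : UU φ φ' f := by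
  refine UU_of_V hφ hbot hlsc hcvx hex fun x hx hxt hne => ?_
  obtain ⟨a, ha⟩ := hne
  refine ⟨a, ha, fun p hp hpt ξ hξ y hy => ?_⟩
  have hxX := interior_subset hx
  have h1 : x ∈ fsubdiff Set.univ (fconj (cExt (edom φ) f)) a := by
    intro η _
    rw [conj_of_sub hbot hxX hxt ha, ← EReal.coe_add]
    refine le_trans (EReal.coe_le_coe_iff.2 ?_) (conj_ge hbot hxX hxt η)
    rw [inner_sub_right]; linarith
  have h2 := h ξ a x h1 hx
  rw [conj_of_sub hbot hxX hxt ha, conj_of_sub hbot (interior_subset hp) hpt hξ,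
    phi_conj_coe hφ hco (ξ - a + φ' x), phi_conj_coe hφ hco (φ' x), phi_conj_grad hφ hx,
    ← EReal.coe_add, ← EReal.coe_sub, EReal.coe_le_coe_iff] at h2
  have h3 := phi_FY hφ hco (ξ - a + φ' x) (interior_subset hy)
  simp only [inner_sub_right, inner_add_right] at h2 h3 ⊢
  simp only [real_inner_comm y, real_inner_comm x, real_inner_comm p] at h2 h3 ⊢
  linarith

lemma UU_dom (hφ : IsDGF φ φ') (hbot : ∀ x ∈ edom φ, f x ≠ ⊥)
    (hlsc : LowerSemicontinuousOn f (edom φ)) (h : UU φ φ' f) :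
    ∀ x ∈ edom φ, f x ≠ ⊤ := by
  intro x hx hxt
  obtain ⟨x0, hx0⟩ := hφ.int_nonempty
  obtain ⟨_, a, _, hS⟩ := h x0 hx0
  set α := ⟪a, x - x0⟫ with hα
  set β := ⟪φ' x0, x - x0⟫ with hβ
  set C : ℝ := (f x0).toReal + |α| + |(φ x).toReal| + |(φ x0).toReal| - (φ x0).toReal + |β| with hC
  have hev := hlsc x hx (C : EReal)
    (show (C : EReal) < f x by rw [hxt]; exact EReal.coe_lt_top _)
  have htend : Tendsto (fun t : ℝ => x + t • (x0 - x)) (𝓝[>] 0) (𝓝 x) := by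
    have : ContinuousAt (fun t : ℝ => x + t • (x0 - x)) 0 := by fun_prop
    have := this.tendsto
    simp only [zero_smul, add_zero] at this
    exact this.mono_left nhdsWithin_le_nhds
  have ht1 : ∀ᶠ t : ℝ in 𝓝[>] 0, t < 1 :=
    nhdsWithin_le_nhds (Iio_mem_nhds (by norm_num))
  have hwint : ∀ᶠ t : ℝ in 𝓝[>] 0, x + t • (x0 - x) ∈ interior (edom φ) := by
    filter_upwards [ht1, self_mem_nhdsWithin] with t ht ht0
    exact (convex_edom hφ.convex).add_smul_sub_mem_interior hx hx0 ⟨ht0, ht.le⟩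
  have htend2 : Tendsto (fun t : ℝ => x + t • (x0 - x)) (𝓝[>] 0) (𝓝[edom φ] x) :=
    tendsto_nhdsWithin_iff.2 ⟨htend, hwint.mono fun t ht => interior_subset ht⟩
  obtain ⟨t, hw, hwi, ht1, ht0⟩ := ((htend2.eventually hev).and (hwint.and
    (ht1.and self_mem_nhdsWithin))).exists
  have ht0 : 0 < t := ht0
  set w := x + t • (x0 - x) with hwd
  have hw : (C : EReal) < f w := hw
  rw [coe_tr (h w hwi).1 (hbot w (interior_subset hwi)), EReal.coe_lt_coe_iff] at hw
  have h1 := hS w hwi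
  have e : (1 - t) • x + t • x0 = w := by rw [hwd]; module
  have e2 : w - x0 = (1 - t) • (x - x0) := by rw [hwd]; module
  have h2 := convE_le hφ.convex (mem_univ x) (mem_univ x0) (a := 1 - t) (b := t)
    (by linarith) ht0.le (by ring) (EReal.le_coe_toReal hx)
    (EReal.le_coe_toReal (interior_subset hx0))
  rw [e, coe_tr (interior_subset hwi) (hφ.ne_bot w), EReal.coe_le_coe_iff] at h2
  rw [e2, inner_smul_right, inner_smul_right, ← hα, ← hβ] at h1
  have a1 : ∀ s v : ℝ, 0 ≤ s → s ≤ 1 → s * v ≤ |v| := fun s v h0 h1 => by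
    nlinarith [le_abs_self v, abs_nonneg v]
  have b1 := a1 (1 - t) α (by linarith) (by linarith)
  have b2 := a1 (1 - t) (-β) (by linarith) (by linarith)
  rw [abs_neg] at b2
  have b3 := a1 (1 - t) (φ x).toReal (by linarith) (by linarith)
  have b4 := a1 t (φ x0).toReal (by linarith) (by linarith)
  linarith

lemma UU_B (hφ : IsDGF φ φ') (hL : Legendre φ φ') (hco : OneCoercive φ)
    (hbot : ∀ x ∈ edom φ, f x ≠ ⊥) (h : UU φ φ' f) :
    ∀ x ∈ interior (edom φ),
        f x = φ x - fconj (fun η => ⨆ ξ : Eucl n,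
          (fconj φ (ξ - η) - fconj (cExt (edom φ) f) ξ)) (-x) := by
  intro x hx
  have hxX := interior_subset hx
  obtain ⟨hxt, a, ha, hS⟩ := h x hx
  have hfin : ∀ x ∈ interior (edom φ), f x ≠ ⊤ := fun x hx => (h x hx).1
  have key : fconj (fun η => ⨆ ξ : Eucl n,
          (fconj φ (ξ - η) - fconj (cExt (edom φ) f) ξ)) (-x) =
      (((φ x).toReal - (f x).toReal : ℝ) : EReal) := by
    apply le_antisymm
    · refine iSup_le fun η => ?_
      have h1 : (((fconj φ (a - η)).toReal - (⟪x, a⟫ - (f x).toReal) : ℝ) : EReal) ≤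
          ⨆ ξ : Eucl n, (fconj φ (ξ - η) - fconj (cExt (edom φ) f) ξ) := by
        refine le_trans ?_ (le_iSup _ a)
        rw [conj_of_sub hbot hxX hxt ha]
        conv_rhs => rw [phi_conj_coe hφ hco (a - η)]
        exact_mod_cast le_refl _
      refine (EReal.sub_le_sub le_rfl h1).trans ?_
      rw [← EReal.coe_sub, EReal.coe_le_coe_iff]
      have h2 := phi_FY hφ hco (a - η) hxX
      rw [inner_sub_right] at h2
      rw [inner_neg_right, real_inner_comm x η]
      linarith
    · refine le_trans ?_ (le_iSup _ (a - φ' x))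
      have h1 : (⨆ ξ : Eucl n, (fconj φ (ξ - (a - φ' x)) - fconj (cExt (edom φ) f) ξ)) ≤
          (((fconj φ (φ' x)).toReal - (⟪x, a⟫ - (f x).toReal) : ℝ) : EReal) := by
        refine iSup_le fun ξ => ?_
        have h2 := D_ineq hφ hL hco hbot hfin hx hS ξ
        rw [show ξ - (a - φ' x) = ξ - a + φ' x by abel]
        refine (EReal.sub_le_sub le_rfl h2).trans ?_
        conv_lhs => rw [phi_conj_coe hφ hco (ξ - a + φ' x)]
        rw [← EReal.coe_sub, EReal.coe_le_coe_iff]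
        simp only [EReal.toReal_coe]
        linarith
      refine le_trans ?_ (EReal.sub_le_sub le_rfl h1)
      rw [← EReal.coe_sub, EReal.coe_le_coe_iff, phi_conj_grad hφ hx, inner_neg_right,
        inner_sub_left]
      simp only [real_inner_comm x]
      linarith
  rw [key]
  conv_rhs => rw [coe_tr hxX (hφ.ne_bot x)]
  conv_lhs => rw [coe_tr hxt (hbot x hxX)]
  rw [← EReal.coe_sub]
  simp only [EReal.toReal_coe]
  congr 1; ring

lemma B_UU (hφ : IsDGF φ φ') (hbot : ∀ x ∈ edom φ, f x ≠ ⊥)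
    (hcvx : ConvexOnE (edom φ) f) (hdom : ∀ x ∈ edom φ, f x ≠ ⊤) (h : Eucl n → EReal)
    (hB : ∀ x ∈ interior (edom φ), f x = φ x - fconj h (-x)) : UU φ φ' f := by
  have hH : ∀ x ∈ interior (edom φ), ∃ c : ℝ, fconj h (-x) = (c : EReal) ∧
      φ x - f x = (c : EReal) := by
    intro x hx
    have hxX := interior_subset hx
    have h1 := hB x hx
    rw [coe_tr (hdom x hxX) (hbot x hxX)] at h1
    rw [coe_tr hxX (hφ.ne_bot x)] at h1 ⊢
    conv in f x => rw [coe_tr (hdom x hxX) (hbot x hxX)]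
    induction hc : fconj h (-x) using EReal.rec with
    | bot => rw [hc, EReal.coe_sub_bot] at h1; exact (EReal.coe_ne_top _ h1).elim
    | top => rw [hc, EReal.sub_top] at h1; exact (EReal.coe_ne_bot _ h1).elim
    | coe c =>
      refine ⟨c, rfl, ?_⟩
      rw [hc, ← EReal.coe_sub, EReal.coe_eq_coe_iff] at h1
      rw [← EReal.coe_sub, EReal.coe_eq_coe_iff]
      linarith
  refine UU_of_conv hφ hbot hcvx (fun x hx => hdom x (interior_subset hx)) ?_
  intro x hx y hy a b ha hb hab
  have hw := (convex_edom hφ.convex).interior hx hy ha hb hab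
  obtain ⟨p, hp1, hp2⟩ := hH x hx
  obtain ⟨q, hq1, hq2⟩ := hH y hy
  obtain ⟨s, hs1, hs2⟩ := hH _ hw
  simp only
  rw [hp2, hq2, hs2, ← hs1]
  refine iSup_le fun η => ?_
  have k1 : ((⟪η, -x⟫ : ℝ) : EReal) - h η ≤ (p : EReal) := by
    rw [← hp1]; exact le_iSup (fun η : Eucl n => ((⟪η, -x⟫ : ℝ) : EReal) - h η) η
  have k2 : ((⟪η, -y⟫ : ℝ) : EReal) - h η ≤ (q : EReal) := by
    rw [← hq1]; exact le_iSup (fun η : Eucl n => ((⟪η, -y⟫ : ℝ) : EReal) - h η) η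
  induction hc : h η using EReal.rec with
  | bot =>
    rw [hc, EReal.coe_sub_bot, top_le_iff] at k1
    exact (EReal.coe_ne_top _ k1).elim
  | top => rw [EReal.sub_top]; exact bot_le
  | coe c =>
    rw [hc, ← EReal.coe_sub, EReal.coe_le_coe_iff] at k1 k2
    rw [← EReal.coe_sub, ← EReal.coe_mul, ← EReal.coe_mul, ← EReal.coe_add, EReal.coe_le_coe_iff]
    rw [inner_neg_right] at k1 k2 ⊢
    rw [inner_add_right, inner_smul_right, inner_smul_right]
    have e : c = a * c + b * c := by rw [← add_mul, hab, one_mul]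
    have m1 := mul_le_mul_of_nonneg_left k1 ha
    have m2 := mul_le_mul_of_nonneg_left k2 hb
    nlinarith

end main2

/-- B-smoothness and cocoercivity.  Let `φ` be a Legendre and
1-coercive dgf and let `f : X → ℝ̄` be proper, lsc on `X`, convex, with
`dom f ∩ int X ≠ ∅`; `f̃` is the canonical extension and `φs = ∇φ*` (gradient of the
everywhere finite `φ*`).  Then the following are equivalent:
(a) `f` is B-smooth: differentiable on `int X` with `φ − f` convex on `int X`;
(b) `dom f = X` and `f = φ − h*(−·)` on `int X`, where
    `h(η) := sup_ξ {φ*(ξ − η) − f̃*(ξ)}`;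
(c) `f` satisfies the extended B-cocoercivity inequality;
(d) `f̃*` satisfies the anisotropic strong convexity inequality.
Each of these implies (e), the B-cocoercivity inequality, and conversely (e) implies
(a)–(d) provided `dom ∂f ⊆ int X`. -/
theorem relative_smoothness_characterization {n : ℕ}
    (φ : Eucl n → EReal) (φ' : Eucl n → Eucl n)
    (hφ : IsDGF φ φ') (hL : Legendre φ φ') (hco : OneCoercive φ)
    (φs : Eucl n → Eucl n)
    (hφs : ∀ v : Eucl n, HasGradientAt (fun ξ => (fconj φ ξ).toReal) (φs v) v)
    (f : Eucl n → EReal)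
    (hproper : ProperOn (edom φ) f) (hlsc : LowerSemicontinuousOn f (edom φ))
    (hcvx : ConvexOnE (edom φ) f)
    (hdomf : ∃ x ∈ interior (edom φ), f x ≠ ⊤) :
    let X : Set (Eucl n) := edom φ
    let ftil : Eucl n → EReal := cExt X f
    let Dstar : Eucl n → Eucl n → EReal := fun u v =>
      fconj φ u - fconj φ v - ((⟪φs v, u - v⟫ : ℝ) : EReal)
    let A : Prop := ∃ f' : Eucl n → Eucl n,
      (∀ x ∈ interior X, HasGradientAt (fun z => (f z).toReal) (f' x) x) ∧
      ConvexOnE (interior X) (fun x => φ x - f x)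
    let B : Prop := (∀ x ∈ X, f x ≠ ⊤) ∧
      ∀ x ∈ interior X,
        f x = φ x - fconj (fun η => ⨆ ξ : Eucl n, (fconj φ (ξ - η) - fconj ftil ξ)) (-x)
    let C : Prop := ∃ f' : Eucl n → Eucl n,
      (∀ x ∈ interior X, HasGradientAt (fun z => (f z).toReal) (f' x) x) ∧
      ∀ xb ∈ interior X, ∀ x ∈ X, ∀ ξ ∈ fsubdiff X f x,
        Dstar (φ' xb - (f' xb - ξ)) (φ' xb) ≤
          f xb - f x - ((⟪ξ, xb - x⟫ : ℝ) : EReal)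
    let D : Prop := ∀ ξ ξb : Eucl n, ∀ xb ∈ fsubdiff Set.univ (fconj ftil) ξb,
      xb ∈ interior X →
        fconj ftil ξb + fconj φ (ξ - ξb + φ' xb) - fconj φ (φ' xb) ≤ fconj ftil ξ
    let E : Prop := ∃ f' : Eucl n → Eucl n,
      (∀ x ∈ interior X, HasGradientAt (fun z => (f z).toReal) (f' x) x) ∧
      ∀ x ∈ interior X, ∀ xb ∈ interior X,
        Dstar (φ' xb - (f' xb - f' x)) (φ' xb) ≤
          f xb - f x - ((⟪f' x, xb - x⟫ : ℝ) : EReal)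
    ((A ↔ B) ∧ (A ↔ C) ∧ (A ↔ D) ∧ (A → E) ∧
      (({x ∈ X | (fsubdiff X f x).Nonempty} ⊆ interior X) → (E → A))) := by
  have hbot := hproper.2
  have hA : (∃ f' : Eucl n → Eucl n,
      (∀ x ∈ interior (edom φ), HasGradientAt (fun z => (f z).toReal) (f' x) x) ∧
      ConvexOnE (interior (edom φ)) (fun x => φ x - f x)) ↔ UU φ φ' f := by
    constructor
    · rintro ⟨f', _, hc⟩
      exact UU_of_conv hφ hbot hcvx (fin_of_conv hφ hbot hdomf hc) hc
    · intro h
      obtain ⟨f', hf'⟩ := UU_spec hφ hbot h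
      exact ⟨f', fun x hx => (hf' x hx).2.1, UU_conv hφ hbot h⟩
  intro X ftil Dstar A B C D E
  refine ⟨hA.trans ⟨?_, ?_⟩, hA.trans ⟨?_, ?_⟩, hA.trans ⟨?_, ?_⟩, fun h => ?_, fun _ h => ?_⟩
  · exact fun h => ⟨UU_dom hφ hbot hlsc h, UU_B hφ hL hco hbot h⟩
  · exact fun h => B_UU hφ hbot hcvx h.1 _ h.2
  · intro h
    obtain ⟨f', h1, h2⟩ := UU_coco hφ hL hco hφs hbot hdomf h
    exact ⟨f', fun x hx => (h1 x hx).1, h2⟩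
  · rintro ⟨f', h1, h2⟩
    exact C_UU hφ hco hφs hbot hlsc hcvx hdomf h1
      fun xb hxb x hx ξ hξ => h2 xb hxb x (interior_subset hx) ξ hξ
  · exact fun h => UU_D hφ hL hco hbot h
  · exact fun h => D_UU hφ hco hbot hlsc hcvx hdomf h
  · obtain ⟨f', h1, h2⟩ := UU_coco hφ hL hco hφs hbot hdomf (hA.1 h)
    exact ⟨f', fun x hx => (h1 x hx).1, fun x hx xb hxb =>
      h2 xb hxb x (interior_subset hx) (f' x) (h1 x hx).2⟩
  · obtain ⟨f', h1, h2⟩ := h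
    exact hA.2 (E_UU hφ hco hφs hbot hlsc hcvx hdomf h1 h2)

end BregmanPaper
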